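/- Let G be a word-hyperbolic group with marked finite generating set A and word metric d_X on X = Γ(G,A), and let H ≤ G be a nontrivial quasiconvex subgroup. Suppose F = F(a,b) ≤ G is a free subgroup of rank two, with word metric d_F relative to the free basis {a,b}, such that the subgroup H₂ = ⟨H, a, b⟩ of G is quasiconvex in G and decomposes as the free product H₂ = H * F(a,b). Then the map ξ : F → Y = Γ(G/H, A) given by ξ(f) = Hf is a quasi-isometric embedding: there exist constants λ, λ' > 0 such that λ·d_F(f₁,f₂) ≤ d_Y(Hf₁, Hf₂) ≤ λ'·d_F(f₁,f₂) for all f₁, f₂ ∈ F. -/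

import Mathlib

/-! ## Words over a marked generating set and word metrics -/

/-- Evaluation of a word in the letters `A × Bool` (a letter together with a sign,
`true` = the letter itself, `false` = its inverse) under a marking `π : A → G`. -/
def evalWord {A G : Type*} [Group G] (π : A → G) (w : List (A × Bool)) : G :=
  (w.map fun p => if p.2 then π p.1 else (π p.1)⁻¹).prod

/-- The word length `|g|_X` of `g ∈ G` with respect to the marked generating set `π : A → G`. -/
noncomputable def wordLen {A G : Type*} [Group G] (π : A → G) (g : G) : ℕ :=
  sInf {n | ∃ w : List (A × Bool), w.length = n ∧ evalWord π w = g}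

/-- The word metric `d_X` on the Cayley graph `X = Γ(G,A)` (restricted to vertices). -/
noncomputable def dX {A G : Type*} [Group G] (π : A → G) (g₁ g₂ : G) : ℕ :=
  wordLen π (g₁⁻¹ * g₂)

/-! ## Discrete geodesics, paths, near-geodesics, thinness, trimness -/

/-- A (discrete) geodesic from `x` to `y` in a graph-like metric `d`:
a sequence of vertices `γ 0 = x, …, γ (d x y) = y` with `d (γ i) (γ j) = |i - j|`. -/
def IsDiscGeodesic {X : Type*} (d : X → X → ℕ) (x y : X) (γ : ℕ → X) : Prop :=
  γ 0 = x ∧ γ (d x y) = y ∧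
    ∀ i j, i ≤ d x y → j ≤ d x y → d (γ i) (γ j) = Nat.dist i j

/-- A discrete edge-path of length `n`: consecutive vertices at distance at most `1`. -/
def IsDiscPath {X : Type*} (d : X → X → ℕ) (γ : ℕ → X) (n : ℕ) : Prop :=
  ∀ i < n, d (γ i) (γ (i + 1)) ≤ 1

/-- A near-geodesic from `x` to `y`: a path `p₁ p' p₂` where `p'` is geodesic and the
initial and terminal segments `p₁, p₂` have length at most `1`. -/
def IsNearGeodesicPath {X : Type*} (d : X → X → ℕ) (x y : X) (γ : ℕ → X) (n : ℕ) : Prop :=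
  γ 0 = x ∧ γ n = y ∧ IsDiscPath d γ n ∧
    ∃ a b : ℕ, a ≤ 1 ∧ b ≤ 1 ∧ a + b ≤ n ∧
      ∀ i j, a ≤ i → i ≤ j → j + b ≤ n → d (γ i) (γ j) = j - i

/-- All geodesic triangles of `(X,d)` are `δ`-thin: every side is contained in the closed
`δ`-neighbourhood of the union of the other two sides. -/
def DiscThinTriangles {X : Type*} (d : X → X → ℕ) (δ : ℝ) : Prop :=
  ∀ x y z (γ₁ γ₂ γ₃ : ℕ → X),
    IsDiscGeodesic d x y γ₁ → IsDiscGeodesic d y z γ₂ → IsDiscGeodesic d z x γ₃ →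
    ∀ i ≤ d x y, ∃ j,
      (j ≤ d y z ∧ (d (γ₁ i) (γ₂ j) : ℝ) ≤ δ) ∨
      (j ≤ d z x ∧ (d (γ₁ i) (γ₃ j) : ℝ) ≤ δ)

/-- All geodesic bigons of `(X,d)` are `δ`-thin: each side is contained in the closed
`δ`-neighbourhood of the other. -/
def DiscThinBigons {X : Type*} (d : X → X → ℕ) (δ : ℝ) : Prop :=
  ∀ x y (α β : ℕ → X), IsDiscGeodesic d x y α → IsDiscGeodesic d x y β →
    (∀ i ≤ d x y, ∃ j ≤ d x y, (d (α i) (β j) : ℝ) ≤ δ) ∧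
    (∀ i ≤ d x y, ∃ j ≤ d x y, (d (β i) (α j) : ℝ) ≤ δ)

/-- The Gromov product `(x,y)_z` with respect to the `ℕ`-valued metric `d`. -/
noncomputable def gromovProd {X : Type*} (d : X → X → ℕ) (x y z : X) : ℝ :=
  ((d z x : ℝ) + (d z y : ℝ) - (d x y : ℝ)) / 2

/-- All geodesic triangles of `(X,d)` are `δ`-trim: two points on two sides which are at the
same distance, at most the Gromov product `(x,y)_z`, from the common vertex `z`, are
`δ`-close (this is required for every labelling of the vertices of the triangle). -/
def DiscTrimTriangles {X : Type*} (d : X → X → ℕ) (δ : ℕ) : Prop :=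
  ∀ x y z (γ₁ γ₂ : ℕ → X), IsDiscGeodesic d z x γ₁ → IsDiscGeodesic d z y γ₂ →
    ∀ i, i ≤ d z x → i ≤ d z y → (i : ℝ) ≤ gromovProd d x y z →
      d (γ₁ i) (γ₂ i) ≤ δ

/-- `S ⊆ G` is `C`-quasiconvex w.r.t. `d`: every geodesic with endpoints in `S`
stays in the closed `C`-neighbourhood of `S`. -/
def DiscQuasiconvex {G : Type*} (d : G → G → ℕ) (S : Set G) (C : ℝ) : Prop :=
  ∀ x y (γ : ℕ → G), x ∈ S → y ∈ S → IsDiscGeodesic d x y γ →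
    ∀ i ≤ d x y, ∃ h ∈ S, (d (γ i) h : ℝ) ≤ C

/-! ## The relative Cayley graph (Schreier coset graph) -/

/-- The right coset `Hg` of `g`, as a vertex of the relative Cayley graph `Γ(G/H,A)`. -/
def rcoset {G : Type*} [Group G] (H : Subgroup G) (g : G) :
    Quotient (QuotientGroup.rightRel H) :=
  Quotient.mk (QuotientGroup.rightRel H) g

/-- Right multiplication `Hg ↦ Hga` on right cosets; this is the map tracing the
edges of the relative Cayley graph. -/
def cosetMul {G : Type*} [Group G] (H : Subgroup G)
    (x : Quotient (QuotientGroup.rightRel H)) (g : G) :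
    Quotient (QuotientGroup.rightRel H) :=
  Quotient.map (· * g) (fun a b hab => by
    have hab' : b * a⁻¹ ∈ H := QuotientGroup.rightRel_apply.mp hab
    show QuotientGroup.rightRel H (a * g) (b * g)
    rw [QuotientGroup.rightRel_apply]
    simpa [mul_inv_rev, mul_assoc] using hab') x

/-- The simplicial metric `d_Y` on (the vertices of) the relative Cayley graph
`Y = Γ(G/H, A)`: the least length of a word in the generators leading from one coset
to the other. -/
noncomputable def dY {A G : Type*} [Group G] (π : A → G) (H : Subgroup G)
    (x y : Quotient (QuotientGroup.rightRel H)) : ℕ :=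
  sInf {n | ∃ w : List (A × Bool), w.length = n ∧ cosetMul H x (evalWord π w) = y}

section WordMetric

variable {A G : Type*} [Group G] {π : A → G}

theorem evalWord_append (π : A → G) (u v : List (A × Bool)) :
    evalWord π (u ++ v) = evalWord π u * evalWord π v := by
  simp [evalWord]

theorem exists_evalWord_inv (π : A → G) (w : List (A × Bool)) :
    ∃ v : List (A × Bool), v.length = w.length ∧ evalWord π v = (evalWord π w)⁻¹ := by
  induction w with
  | nil => exact ⟨[], rfl, by simp [evalWord]⟩
  | cons p w ih =>
    obtain ⟨v, hv, hvw⟩ := ih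
    refine ⟨v ++ [(p.1, !p.2)], by simp [hv], ?_⟩
    rw [evalWord_append, hvw]
    rcases p with ⟨x, _ | _⟩ <;> simp [evalWord]

theorem wordLen_evalWord_le (π : A → G) (w : List (A × Bool)) :
    wordLen π (evalWord π w) ≤ w.length :=
  Nat.sInf_le ⟨w, rfl, rfl⟩

theorem exists_evalWord_eq (hgen : Subgroup.closure (Set.range π) = ⊤) (g : G) :
    ∃ w, evalWord π w = g := by
  have hg : g ∈ Subgroup.closure (Set.range π) := hgen ▸ Subgroup.mem_top g
  induction hg using Subgroup.closure_induction with
  | mem _ h =>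
    obtain ⟨x, rfl⟩ := h
    exact ⟨[(x, true)], by simp [evalWord]⟩
  | one => exact ⟨[], by simp [evalWord]⟩
  | mul _ _ _ _ h₁ h₂ =>
    obtain ⟨u, rfl⟩ := h₁
    obtain ⟨v, rfl⟩ := h₂
    exact ⟨u ++ v, evalWord_append π u v⟩
  | inv _ _ h =>
    obtain ⟨u, rfl⟩ := h
    obtain ⟨v, -, hv⟩ := exists_evalWord_inv π u
    exact ⟨v, hv⟩

theorem exists_evalWord_length_eq_wordLen (hgen : Subgroup.closure (Set.range π) = ⊤) (g : G) :
    ∃ w : List (A × Bool), w.length = wordLen π g ∧ evalWord π w = g := by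
  obtain ⟨w, hw⟩ := exists_evalWord_eq hgen g
  exact Nat.sInf_mem (s := {n | ∃ w : List (A × Bool), w.length = n ∧ evalWord π w = g})
    ⟨w.length, w, rfl, hw⟩

theorem wordLen_one (π : A → G) : wordLen π 1 = 0 :=
  Nat.le_zero.mp (wordLen_evalWord_le π [])

theorem wordLen_mul_le (hgen : Subgroup.closure (Set.range π) = ⊤) (g h : G) :
    wordLen π (g * h) ≤ wordLen π g + wordLen π h := by
  obtain ⟨u, hu, rfl⟩ := exists_evalWord_length_eq_wordLen hgen g
  obtain ⟨v, hv, rfl⟩ := exists_evalWord_length_eq_wordLen hgen h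
  rw [← evalWord_append, ← hu, ← hv, ← List.length_append]
  exact wordLen_evalWord_le π _

theorem wordLen_inv_le (hgen : Subgroup.closure (Set.range π) = ⊤) (g : G) :
    wordLen π g⁻¹ ≤ wordLen π g := by
  obtain ⟨u, hu, rfl⟩ := exists_evalWord_length_eq_wordLen hgen g
  obtain ⟨v, hv, hvu⟩ := exists_evalWord_inv π u
  rw [← hu, ← hv, ← hvu]
  exact wordLen_evalWord_le π v

theorem dX_comm (hgen : Subgroup.closure (Set.range π) = ⊤) (g h : G) :
    dX π g h = dX π h g := by
  have key (g h : G) : dX π g h ≤ dX π h g := by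
    simpa [dX] using wordLen_inv_le hgen (h⁻¹ * g)
  exact le_antisymm (key g h) (key h g)

theorem dX_triangle (hgen : Subgroup.closure (Set.range π) = ⊤) (g h k : G) :
    dX π g k ≤ dX π g h + dX π h k := by
  simpa [dX, mul_assoc] using wordLen_mul_le hgen (g⁻¹ * h) (h⁻¹ * k)

theorem finite_setOf_wordLen_le [Finite A] (hgen : Subgroup.closure (Set.range π) = ⊤) (n : ℕ) :
    {g : G | wordLen π g ≤ n}.Finite := by
  refine ((List.finite_length_le (A × Bool) n).image (evalWord π)).subset fun g hg => ?_
  obtain ⟨w, hw, rfl⟩ := exists_evalWord_length_eq_wordLen hgen g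
  exact ⟨w, hw.trans_le hg, rfl⟩

theorem dX_evalWord_take_le (π : A → G) (w : List (A × Bool)) {i j : ℕ} (hij : i ≤ j) :
    dX π (evalWord π (w.take i)) (evalWord π (w.take j)) ≤ j - i := by
  have h : evalWord π (w.take j) =
      evalWord π (w.take i) * evalWord π ((w.take j).drop i) := by
    rw [← evalWord_append]
    conv_lhs => rw [← List.take_append_drop i (w.take j), List.take_take, min_eq_left hij]
  rw [dX, h, inv_mul_cancel_left]
  refine (wordLen_evalWord_le π _).trans ?_
  simp only [List.length_drop, List.length_take]
  omega

/-- The prefixes of a shortest word for `g` trace a geodesic from `1` to `g`. -/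
theorem isDiscGeodesic_evalWord_take (hgen : Subgroup.closure (Set.range π) = ⊤)
    (w : List (A × Bool)) (hw : w.length = wordLen π (evalWord π w)) :
    IsDiscGeodesic (dX π) 1 (evalWord π w) fun i => evalWord π (w.take i) := by
  have hd : dX π 1 (evalWord π w) = w.length := by simp [dX, hw]
  have key {i j : ℕ} (hij : i ≤ j) (hj : j ≤ w.length) :
      dX π (evalWord π (w.take i)) (evalWord π (w.take j)) = j - i := by
    have h₁ := dX_evalWord_take_le π w (Nat.zero_le i)
    have h₂ := dX_evalWord_take_le π w hij
    have h₃ := dX_evalWord_take_le π w hj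
    have h₄ := dX_triangle hgen (evalWord π (w.take 0)) (evalWord π (w.take i))
      (evalWord π (w.take w.length))
    have h₅ := dX_triangle hgen (evalWord π (w.take i)) (evalWord π (w.take j))
      (evalWord π (w.take w.length))
    have h₆ : dX π (evalWord π (w.take 0)) (evalWord π (w.take w.length)) = w.length := by
      rw [List.take_length, ← hd]
      simp [evalWord]
    omega
  refine ⟨by simp [evalWord], by simp [hd], fun i j hi hj => ?_⟩
  rw [hd] at hi hj
  rcases le_total i j with h | h
  · rw [key h hj, Nat.dist_eq_sub_of_le h]
  · rw [dX_comm hgen, key h hi, Nat.dist_eq_sub_of_le_right h]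

/-- If an injective homomorphism `ψ` has quasiconvex range, then every subadditive function
on its domain that vanishes at `1` is bounded linearly by the word length in the target. -/
theorem exists_le_mul_wordLen_of_quasiconvex_range [Finite A]
    (hgen : Subgroup.closure (Set.range π) = ⊤) {P : Type*} [Group P] (ψ : P →* G)
    (hψ : Function.Injective ψ) {C : ℝ} (hqc : DiscQuasiconvex (dX π) (ψ.range : Set G) C)
    (ℓ : P → ℕ) (hone : ℓ 1 = 0) (hmul : ∀ x y, ℓ (x * y) ≤ ℓ x + ℓ y) :
    ∃ M : ℕ, ∀ x, ℓ x ≤ M * wordLen π (ψ x) := by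
  set c : ℕ := ⌊C⌋₊
  have hfin : {x : P | wordLen π (ψ x) ≤ 2 * c + 1}.Finite :=
    (finite_setOf_wordLen_le hgen (2 * c + 1)).preimage hψ.injOn
  obtain ⟨M, hM⟩ := (hfin.image ℓ).bddAbove
  replace hM (x : P) (hx : wordLen π (ψ x) ≤ 2 * c + 1) : ℓ x ≤ M := hM ⟨x, hx, rfl⟩
  refine ⟨2 * M, fun x => ?_⟩
  obtain ⟨w, hw, hwx⟩ := exists_evalWord_length_eq_wordLen hgen (ψ x)
  have hgeo := isDiscGeodesic_evalWord_take hgen w (by rw [hwx, hw])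
  rw [hwx] at hgeo
  have hd : dX π 1 (ψ x) = w.length := by simp [dX, hw]
  have near (i : ℕ) (hi : i ≤ w.length) : ∃ y, dX π (evalWord π (w.take i)) (ψ y) ≤ c := by
    obtain ⟨_, ⟨y, rfl⟩, hy⟩ := hqc 1 (ψ x) _ (one_mem ψ.range) ⟨x, rfl⟩ hgeo i (hd ▸ hi)
    exact ⟨y, Nat.le_floor hy⟩
  have bound (i : ℕ) (hi : i ≤ w.length) :
      ∀ y, dX π (evalWord π (w.take i)) (ψ y) ≤ c → ℓ y ≤ M * (i + 1) := by
    induction i with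
    | zero =>
      intro y hy
      have : wordLen π (ψ y) ≤ c := by simpa [dX, evalWord] using hy
      simpa using hM y (by omega)
    | succ i ih =>
      intro y hy
      obtain ⟨z, hz⟩ := near i (by omega)
      have hstep := dX_evalWord_take_le π w (Nat.le_add_right i 1)
      have h₁ := dX_triangle hgen (ψ z) (evalWord π (w.take i)) (ψ y)
      have h₂ := dX_triangle hgen (evalWord π (w.take i)) (evalWord π (w.take (i + 1))) (ψ y)
      rw [dX_comm hgen (ψ z) (evalWord π (w.take i))] at h₁
      have hzy : ℓ (z⁻¹ * y) ≤ M := by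
        refine hM _ ?_
        rw [map_mul, map_inv]
        change dX π (ψ z) (ψ y) ≤ _
        omega
      have hy' := hmul z (z⁻¹ * y)
      rw [mul_inv_cancel_left] at hy'
      have hz' := ih (by omega) z hz
      rw [mul_add M (i + 1) 1]
      omega
  rcases Nat.eq_zero_or_pos w.length with h₀ | hpos
  · have : ψ x = 1 := by rw [← hwx, List.length_eq_zero_iff.mp h₀]; simp [evalWord]
    rw [hψ (this.trans (map_one ψ).symm), hone]
    exact Nat.zero_le _
  · have hx := bound w.length le_rfl x (by simp [hwx, dX, wordLen_one])
    rw [← hw]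
    nlinarith

theorem exists_wordLen_map_freeGroup_le {α : Type*} [Finite α] [DecidableEq α]
    (hgen : Subgroup.closure (Set.range π) = ⊤) (φ : FreeGroup α →* G) :
    ∃ K : ℕ, ∀ f, wordLen π (φ f) ≤ K * f.toWord.length := by
  obtain ⟨K, hK⟩ := (Set.finite_range fun p : α × Bool =>
    wordLen π (φ (FreeGroup.mk [p]))).bddAbove
  have key (L : List (α × Bool)) : wordLen π (φ (FreeGroup.mk L)) ≤ K * L.length := by
    induction L with
    | nil => simp [← FreeGroup.one_eq_mk, wordLen_one]
    | cons p L ih =>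
      have h : (FreeGroup.mk (p :: L) : FreeGroup α) = FreeGroup.mk [p] * FreeGroup.mk L := by
        simp [FreeGroup.mul_mk]
      have hp : wordLen π (φ (FreeGroup.mk [p])) ≤ K := hK ⟨p, rfl⟩
      rw [h, map_mul, List.length_cons, mul_add, mul_one]
      exact (wordLen_mul_le hgen _ _).trans (by omega)
  exact ⟨K, fun f => by simpa only [FreeGroup.mk_toWord] using key f.toWord⟩

theorem cosetMul_rcoset_eq_iff (H : Subgroup G) (g k x : G) :
    cosetMul H (rcoset H g) x = rcoset H k ↔ k * (g * x)⁻¹ ∈ H := by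
  rw [← QuotientGroup.rightRel_apply]
  exact Quotient.eq (r := QuotientGroup.rightRel H) (x := g * x) (y := k)

theorem dY_rcoset_le_dX (hgen : Subgroup.closure (Set.range π) = ⊤) (H : Subgroup G) (g k : G) :
    dY π H (rcoset H g) (rcoset H k) ≤ dX π g k := by
  obtain ⟨w, hw, hwg⟩ := exists_evalWord_length_eq_wordLen hgen (g⁻¹ * k)
  exact Nat.sInf_le ⟨w, hw, by simp [cosetMul_rcoset_eq_iff, hwg]⟩

/-- The distance between two cosets is at least the length of some element of `g⁻¹ H k`. -/
theorem exists_wordLen_le_dY (hgen : Subgroup.closure (Set.range π) = ⊤) (H : Subgroup G)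
    (g k : G) : ∃ h : H, wordLen π (g⁻¹ * h * k) ≤ dY π H (rcoset H g) (rcoset H k) := by
  obtain ⟨v, hv⟩ := exists_evalWord_eq hgen (g⁻¹ * k)
  obtain ⟨w, hw, hwg⟩ := Nat.sInf_mem (s := {n | ∃ w : List (A × Bool), w.length = n ∧
      cosetMul H (rcoset H g) (evalWord π w) = rcoset H k})
    ⟨v.length, v, rfl, by simp [cosetMul_rcoset_eq_iff, hv]⟩
  rw [cosetMul_rcoset_eq_iff] at hwg
  refine ⟨⟨_, hwg⟩⁻¹, ?_⟩
  have h : g⁻¹ * ((⟨_, hwg⟩ : H)⁻¹ : H) * k = evalWord π w := by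
    simp [mul_assoc]
  rw [h]
  exact (wordLen_evalWord_le π w).trans hw.le

end WordMetric

theorem range_lift_freeGroup_bool {G : Type*} [Group G] (H : Subgroup G)
    (φ : FreeGroup Bool →* G) :
    (Monoid.Coprod.lift H.subtype φ).range =
      Subgroup.closure ((H : Set G) ∪ {φ (FreeGroup.of true), φ (FreeGroup.of false)}) := by
  have hφ : φ.range = Subgroup.closure {φ (FreeGroup.of true), φ (FreeGroup.of false)} := by
    rw [MonoidHom.range_eq_map, ← FreeGroup.closure_range_of, MonoidHom.map_closure,
      ← Set.range_comp]
    congr 1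
    ext x
    simp [or_comm]
  rw [Monoid.Coprod.range_lift, Subgroup.closure_union, Subgroup.closure_eq, H.range_subtype, hφ]

/-- **The quasi-isometric embedding `ξ` in the proof of Theorem 5.4.**  Let `G` be a
word-hyperbolic group with marked finite generating set `A` (given by `π : A → G`), with
Cayley graph `X = Γ(G,A)` and word metric `d_X`, and let `H ≤ G` be a nontrivial
quasiconvex subgroup.  Suppose `F = F(a,b) ≤ G` is a free subgroup of rank two (the image
of an injective homomorphism `φ` from the free group on two letters sending the free
generators to `a` and `b`), with word metric `d_F` relative to the free basis `{a,b}`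
(`d_F(f₁,f₂)` is the reduced length of `f₁⁻¹f₂`), such that the subgroup `H₂ = ⟨H, a, b⟩`
of `G` is quasiconvex in `G` and decomposes as the free product `H₂ = H ∗ F(a,b)` (i.e.
the canonical homomorphism `H ∗ F(a,b) → G` is injective).  Then the map
`ξ : F → Y = Γ(G/H,A)`, `ξ(f) = Hf`, is a quasi-isometric embedding: there are constants
`λ, λ' > 0` with `λ·d_F(f₁,f₂) ≤ d_Y(Hφ(f₁), Hφ(f₂)) ≤ λ'·d_F(f₁,f₂)` for all
`f₁, f₂ ∈ F`. -/
theorem coset_map_on_free_subgroup_is_qi_embedding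
    {A G : Type*} [Group G] [Fintype A] (π : A → G)
    (hgen : Subgroup.closure (Set.range π) = ⊤)
    (hhyp : ∃ δ : ℝ, 0 ≤ δ ∧ DiscThinTriangles (dX π) δ)
    (H : Subgroup G) (hHnontriv : H ≠ ⊥)
    (hqcH : ∃ C : ℝ, 0 < C ∧ DiscQuasiconvex (dX π) (H : Set G) C)
    (a b : G) (φ : FreeGroup Bool →* G)
    (hφa : φ (FreeGroup.of true) = a) (hφb : φ (FreeGroup.of false) = b)
    (hφinj : Function.Injective φ)
    (H₂ : Subgroup G) (hH₂ : H₂ = Subgroup.closure ((H : Set G) ∪ {a, b}))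
    (hqcH₂ : ∃ C : ℝ, 0 < C ∧ DiscQuasiconvex (dX π) (H₂ : Set G) C)
    (hfree : Function.Injective (Monoid.Coprod.lift H.subtype φ)) :
    ∃ lam lam' : ℝ, 0 < lam ∧ 0 < lam' ∧
      ∀ f₁ f₂ : FreeGroup Bool,
        lam * ((f₁⁻¹ * f₂).toWord.length : ℝ) ≤
            (dY π H (rcoset H (φ f₁)) (rcoset H (φ f₂)) : ℝ) ∧
        (dY π H (rcoset H (φ f₁)) (rcoset H (φ f₂)) : ℝ) ≤
            lam' * ((f₁⁻¹ * f₂).toWord.length : ℝ) := by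
  obtain ⟨C, -, hqc⟩ := hqcH₂
  subst hφa hφb hH₂
  rw [← range_lift_freeGroup_bool] at hqc
  obtain ⟨M, hM⟩ := exists_le_mul_wordLen_of_quasiconvex_range hgen _ hfree hqc
    (fun x => (Monoid.Coprod.snd x).norm) (by simp)
    (fun x y => by simpa using FreeGroup.norm_mul_le _ _)
  obtain ⟨K, hK⟩ := exists_wordLen_map_freeGroup_le hgen φ
  refine ⟨((M : ℝ) + 1)⁻¹, (K : ℝ) + 1, by positivity, by positivity, fun f₁ f₂ => ⟨?_, ?_⟩⟩
  · obtain ⟨h, hh⟩ := exists_wordLen_le_dY hgen H (φ f₁) (φ f₂)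
    have hx := hM (Monoid.Coprod.inr f₁⁻¹ * Monoid.Coprod.inl h * Monoid.Coprod.inr f₂)
    simp only [map_mul, Monoid.Coprod.snd_apply_inr, Monoid.Coprod.snd_apply_inl, mul_one,
      Monoid.Coprod.lift_apply_inr, Monoid.Coprod.lift_apply_inl, map_inv,
      Subgroup.subtype_apply] at hx
    rw [inv_mul_le_iff₀ (by positivity)]
    have : (f₁⁻¹ * f₂).toWord.length ≤
        (M + 1) * dY π H (rcoset H (φ f₁)) (rcoset H (φ f₂)) :=
      hx.trans (Nat.mul_le_mul (Nat.le_succ M) hh)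
    exact_mod_cast this
  · have h := (dY_rcoset_le_dX hgen H (φ f₁) (φ f₂)).trans
      (by simpa [dX] using hK (f₁⁻¹ * f₂))
    have : dY π H (rcoset H (φ f₁)) (rcoset H (φ f₂)) ≤
        (K + 1) * (f₁⁻¹ * f₂).toWord.length :=
      h.trans (Nat.mul_le_mul_right _ (Nat.le_succ K))
    exact_mod_cast this
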